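/- (Universal upper bound on separation rank.) Define C(L) := (3^L − 1)/2. For any depth L ≥ 1, input size N > 1, any partition of [N] into disjoint sets P, Q with P ∪ Q = [N] (not necessarily balanced), any weight configuration Θ, and any output location i ∈ [N], p ∈ [d_x]: sep(y_p^{i,L,d_x,H,Θ}; P, Q) ≤ (H·(d_a + 1))^{C(L)}. -/

import Mathlib

open scoped BigOperators
open MeasureTheory Matrix

set_option synthInstance.maxSize 4000

/-- Per-head weights `(W^K, W^Q, W^V, W^O)`, stored as plain arrays of reals so that the
weight space carries its natural (Lebesgue) `MeasureSpace` structure. -/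
abbrev HeadWeights (da dx : ℕ) : Type :=
  (Fin da → Fin dx → ℝ) × (Fin da → Fin dx → ℝ) ×
  (Fin da → Fin dx → ℝ) × (Fin dx → Fin da → ℝ)

/-- The weight configuration Θ of a depth-`L`, `H`-headed self-attention network,
a point of `ℝ^{4·L·H·d_a·d_x}` (carrying Lebesgue measure `volume`). -/
abbrev SAWeights (L H da dx : ℕ) : Type := Fin L → Fin H → HeadWeights da dx

/-- A single (multi-headed) self-attention layer:
`y^i = Σ_{j=1}^N Σ_{h=1}^H ⟨W^{Q,h} x^i, W^{K,h} x^j⟩ W^{O,h} W^{V,h} x^j`. -/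
noncomputable def saLayer {N H da dx : ℕ} (W : Fin H → HeadWeights da dx)
    (x : Fin N → Fin dx → ℝ) : Fin N → Fin dx → ℝ := fun i =>
  ∑ j : Fin N, ∑ h : Fin H,
    (∑ a : Fin da, (Matrix.of (W h).2.1).mulVec (x i) a * (Matrix.of (W h).1).mulVec (x j) a) •
      (Matrix.of (W h).2.2.2).mulVec ((Matrix.of (W h).2.2.1).mulVec (x j))

/-- `l`-fold composition of self-attention layers. -/
noncomputable def saNetAux {N H da dx : ℕ} (W : ℕ → Fin H → HeadWeights da dx) :
    ℕ → (Fin N → Fin dx → ℝ) → (Fin N → Fin dx → ℝ)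
  | 0, x => x
  | (l + 1), x => saLayer (W l) (saNetAux W l x)

noncomputable def extendW {L H da dx : ℕ} (Θ : SAWeights L H da dx) :
    ℕ → Fin H → HeadWeights da dx := fun l =>
  if h : l < L then Θ ⟨l, h⟩ else fun _ => 0

/-- `y_p^{i,L,d_x,H,Θ}` : the `p`-th coordinate of the depth-`L` self-attention
network output at position `i`, as a scalar function of the `N` inputs. -/
noncomputable def saOutput {H da dx : ℕ} (L N : ℕ) (Θ : SAWeights L H da dx)
    (i : Fin N) (p : Fin dx) (x : Fin N → Fin dx → ℝ) : ℝ :=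
  saNetAux (extendW Θ) L x i p

/-- `f` depends only on the input vectors at positions in `A`. -/
def DependsOnlyOn {N dx : ℕ} (f : (Fin N → Fin dx → ℝ) → ℝ) (A : Finset (Fin N)) : Prop :=
  ∀ x y : Fin N → Fin dx → ℝ, (∀ j ∈ A, x j = y j) → f x = f y

/-- The separation rank of `f : (ℝ^{d_x})^N → ℝ` w.r.t. the partition `(A,B)`:
the minimal number `R` of summands, each a product of a function of the inputs indexed
by `A` with a function of the inputs indexed by `B`, summing up to `f` (`⊤` if no
finite such decomposition exists). -/
noncomputable def sepRank {N dx : ℕ} (f : (Fin N → Fin dx → ℝ) → ℝ)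
    (A B : Finset (Fin N)) : ℕ∞ :=
  sInf {R : ℕ∞ | ∃ n : ℕ, R = (n : ℕ∞) ∧
    ∃ g g' : Fin n → ((Fin N → Fin dx → ℝ) → ℝ),
      (∀ r, DependsOnlyOn (g r) A) ∧ (∀ r, DependsOnlyOn (g' r) B) ∧
      ∀ x, f x = ∑ r : Fin n, g r x * g' r x}

/-- `C(L) = (3^L − 1)/2`. -/
def CL (L : ℕ) : ℕ := (3 ^ L - 1) / 2

/-- The Gram matrix `∑ j ∈ A, x^j (x^j)ᵀ` of the inputs at the positions in `A`. -/
noncomputable def inputGram {N dx : ℕ} (A : Finset (Fin N)) (x : Fin N → Fin dx → ℝ) :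
    Matrix (Fin dx) (Fin dx) ℝ :=
  ∑ j ∈ A, Matrix.vecMulVec (x j) (x j)

/-- The product `W^O W^V` of a head. -/
def headOV {da dx : ℕ} (w : HeadWeights da dx) : Matrix (Fin dx) (Fin dx) ℝ :=
  Matrix.of w.2.2.2 * Matrix.of w.2.2.1

/-- The product `(W^K)ᵀ W^Q` of a head. -/
def headKQ {da dx : ℕ} (w : HeadWeights da dx) : Matrix (Fin dx) (Fin dx) ℝ :=
  (Matrix.of w.1)ᵀ * Matrix.of w.2.1

/-- The matrix, depending on the inputs only through their Gram matrix, by which the first `l`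
layers act on each input vector. -/
noncomputable def transfer {N H da dx : ℕ} (W : ℕ → Fin H → HeadWeights da dx) :
    ℕ → (Fin N → Fin dx → ℝ) → Matrix (Fin dx) (Fin dx) ℝ
  | 0, _ => 1
  | l + 1, x => ∑ h, headOV (W l h) * (transfer W l x * (inputGram Finset.univ x *
      ((transfer W l x)ᵀ * (headKQ (W l h) * transfer W l x))))

/-- A scalar function of the inputs in `B` times a vector-valued function of the inputs in `A`. -/
def IsSepTerm {N dx m : ℕ} (A B : Finset (Fin N))
    (f : (Fin N → Fin dx → ℝ) → Fin m → ℝ) : Prop :=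
  ∃ (g : (Fin N → Fin dx → ℝ) → ℝ) (v : (Fin N → Fin dx → ℝ) → Fin m → ℝ),
    DependsOnlyOn g B ∧ (∀ a, DependsOnlyOn (fun x => v x a) A) ∧ f = fun x => g x • v x

/-- The vector-valued functions that are a single separated term, in one of the two orders. -/
def sepTerms {N : ℕ} (dx m : ℕ) (P Q : Finset (Fin N)) :
    Set ((Fin N → Fin dx → ℝ) → Fin m → ℝ) :=
  {f | IsSepTerm P Q f ∨ IsSepTerm Q P f}

/-- Separated terms factoring through a fixed linear map out of `ℝ^da`. -/
def lowSepTerms {N : ℕ} (dx m da : ℕ) (P Q : Finset (Fin N)) :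
    Set ((Fin N → Fin dx → ℝ) → Fin m → ℝ) :=
  {f | ∃ (C : Matrix (Fin m) (Fin da) ℝ), ∃ s ∈ sepTerms dx da P Q, f = fun x => C *ᵥ s x}

/-- `f` is a sum of `n` elements of `S`. -/
def IsSumOf {M : Type*} [AddCommMonoid M] (S : Set M) (n : ℕ) (f : M) : Prop :=
  ∃ F : Fin n → M, (∀ r, F r ∈ S) ∧ f = ∑ r, F r

theorem IsSumOf.of_mem {M : Type*} [AddCommMonoid M] {S : Set M} {f : M} (hf : f ∈ S) :
    IsSumOf S 1 f :=
  ⟨fun _ => f, fun _ => hf, by simp⟩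

theorem IsSumOf.add {M : Type*} [AddCommMonoid M] {S : Set M} {m n : ℕ} {f g : M}
    (hf : IsSumOf S m f) (hg : IsSumOf S n g) : IsSumOf S (m + n) (f + g) := by
  obtain ⟨F, hF, rfl⟩ := hf
  obtain ⟨G, hG, rfl⟩ := hg
  refine ⟨Fin.append F G, fun r => ?_, by simp [Fin.sum_univ_add]⟩
  induction r using Fin.addCases with
  | left r => simpa using hF r
  | right r => simpa using hG r

theorem IsSumOf.sum {M : Type*} [AddCommMonoid M] {S : Set M} {m n : ℕ} {F : Fin n → M}
    (hF : ∀ r, IsSumOf S m (F r)) : IsSumOf S (n * m) (∑ r, F r) := by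
  choose G hG hFG using hF
  refine ⟨fun r => G (finProdFinEquiv.symm r).1 (finProdFinEquiv.symm r).2,
    fun r => hG _ _, ?_⟩
  rw [finProdFinEquiv.symm.sum_comp (fun q : Fin n × Fin m => G q.1 q.2), Fintype.sum_prod_type]
  exact Finset.sum_congr rfl fun r _ => hFG r

theorem IsSumOf.mulVec {X : Type*} {a b n m : ℕ} {S : Set (X → Fin a → ℝ)}
    {S' : Set (X → Fin b → ℝ)} {f : X → Fin a → ℝ} (M : X → Matrix (Fin b) (Fin a) ℝ)
    (hf : IsSumOf S n f) (hM : ∀ s ∈ S, IsSumOf S' m (fun x => M x *ᵥ s x)) :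
    IsSumOf S' (n * m) (fun x => M x *ᵥ f x) := by
  obtain ⟨F, hF, rfl⟩ := hf
  have h : (fun x => M x *ᵥ (∑ r, F r) x) = ∑ r, fun x => M x *ᵥ F r x := by
    funext x
    simp [Finset.sum_apply, Matrix.mulVec_sum]
  rw [h]
  exact IsSumOf.sum fun r => hM _ (hF r)

theorem IsSumOf.mulVec_of_mem {X : Type*} {a b n : ℕ} {S : Set (X → Fin a → ℝ)}
    {S' : Set (X → Fin b → ℝ)} {f : X → Fin a → ℝ} (M : X → Matrix (Fin b) (Fin a) ℝ)
    (hf : IsSumOf S n f) (hM : ∀ s ∈ S, (fun x => M x *ᵥ s x) ∈ S') :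
    IsSumOf S' n (fun x => M x *ᵥ f x) := by
  simpa using hf.mulVec M fun s hs => IsSumOf.of_mem (hM s hs)

section SepTerms

variable {N dx m k da : ℕ} {A B P Q : Finset (Fin N)}

theorem IsSepTerm.const_mulVec (C : Matrix (Fin k) (Fin m) ℝ)
    {s : (Fin N → Fin dx → ℝ) → Fin m → ℝ} (hs : IsSepTerm A B s) :
    IsSepTerm A B (fun x => C *ᵥ s x) := by
  obtain ⟨g, v, hg, hv, rfl⟩ := hs
  refine ⟨g, fun x => C *ᵥ v x, hg, fun a x y hxy => ?_, ?_⟩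
  · have : v x = v y := funext fun b => hv b x y hxy
    simp only [this]
  · funext x
    rw [Matrix.mulVec_smul]

theorem const_mulVec_mem_sepTerms (C : Matrix (Fin k) (Fin m) ℝ)
    {s : (Fin N → Fin dx → ℝ) → Fin m → ℝ} (hs : s ∈ sepTerms dx m P Q) :
    (fun x => C *ᵥ s x) ∈ sepTerms dx k P Q :=
  hs.imp (fun h => h.const_mulVec C) fun h => h.const_mulVec C

theorem mul_mulVec_mem_lowSepTerms (C : Matrix (Fin k) (Fin da) ℝ) (D : Matrix (Fin da) (Fin m) ℝ)
    {s : (Fin N → Fin dx → ℝ) → Fin m → ℝ} (hs : s ∈ sepTerms dx m P Q) :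
    (fun x => (C * D) *ᵥ s x) ∈ lowSepTerms dx k da P Q :=
  ⟨C, _, const_mulVec_mem_sepTerms D hs, by simp [Matrix.mulVec_mulVec]⟩

theorem const_mulVec_mem_lowSepTerms (C : Matrix (Fin k) (Fin m) ℝ)
    {s : (Fin N → Fin dx → ℝ) → Fin m → ℝ} (hs : s ∈ lowSepTerms dx m da P Q) :
    (fun x => C *ᵥ s x) ∈ lowSepTerms dx k da P Q := by
  obtain ⟨D, s, hs, rfl⟩ := hs
  exact ⟨C * D, s, hs, by simp [Matrix.mulVec_mulVec]⟩

theorem inputGram_congr {x y : Fin N → Fin dx → ℝ} (h : ∀ j ∈ A, x j = y j) :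
    inputGram A x = inputGram A y :=
  Finset.sum_congr rfl fun j hj => by rw [h j hj]

theorem inputGram_univ (hAB : Disjoint A B) (hcov : A ∪ B = Finset.univ) (x : Fin N → Fin dx → ℝ) :
    inputGram Finset.univ x = inputGram A x + inputGram B x := by
  rw [inputGram, ← hcov, Finset.sum_union hAB]
  rfl

theorem IsSepTerm.inputGram_mulVec (hAB : Disjoint A B) (hcov : A ∪ B = Finset.univ)
    (C : Matrix (Fin dx) (Fin da) ℝ) {s : (Fin N → Fin dx → ℝ) → Fin da → ℝ}
    (hs : IsSepTerm A B s) :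
    IsSumOf {f | IsSepTerm A B f ∨ IsSepTerm B A f} (da + 1)
      (fun x => inputGram Finset.univ x *ᵥ (C *ᵥ s x)) := by
  obtain ⟨g, v, hg, hv, rfl⟩ := hs
  have hsplit : (fun x => inputGram Finset.univ x *ᵥ (C *ᵥ (g x • v x))) =
      (∑ a : Fin da, fun x => v x a • (g x • (inputGram B x * C).col a)) +
        fun x => g x • (inputGram A x *ᵥ (C *ᵥ v x)) := by
    funext x p
    simp only [inputGram_univ hAB hcov, Matrix.add_mulVec, Matrix.mulVec_smul, Pi.add_apply,
      Finset.sum_apply, Pi.smul_apply, smul_eq_mul, Matrix.col_apply]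
    rw [mul_add, add_comm, Matrix.mulVec_mulVec (M := inputGram B x)]
    congr 1
    rw [Matrix.mulVec, dotProduct, Finset.mul_sum]
    exact Finset.sum_congr rfl fun a _ => by ring
  rw [hsplit]
  refine IsSumOf.add ?_ (IsSumOf.of_mem (Or.inl ?_))
  · refine ⟨_, fun a => Or.inr ?_, rfl⟩
    refine ⟨fun x => v x a, _, hv a, fun b x y hxy => ?_, rfl⟩
    simp only [inputGram_congr hxy, hg x y hxy]
  · refine ⟨g, _, hg, fun b x y hxy => ?_, rfl⟩
    have : v x = v y := funext fun b => hv b x y hxy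
    simp only [inputGram_congr hxy, this]

theorem isSumOf_inputGram_mulVec (hPQ : Disjoint P Q) (hcov : P ∪ Q = Finset.univ)
    {s : (Fin N → Fin dx → ℝ) → Fin dx → ℝ} (hs : s ∈ lowSepTerms dx dx da P Q) :
    IsSumOf (sepTerms dx dx P Q) (da + 1) (fun x => inputGram Finset.univ x *ᵥ s x) := by
  obtain ⟨C, s, hs | hs, rfl⟩ := hs
  · exact hs.inputGram_mulVec hPQ hcov C
  · have h := hs.inputGram_mulVec hPQ.symm (Finset.union_comm P Q ▸ hcov) C
    simpa only [sepTerms, or_comm] using h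

theorem input_mem_sepTerms (hcov : P ∪ Q = Finset.univ) (i : Fin N) :
    (fun x : Fin N → Fin dx → ℝ => x i) ∈ sepTerms dx dx P Q := by
  have key (A B : Finset (Fin N)) (hi : i ∈ A) :
      IsSepTerm A B (fun x : Fin N → Fin dx → ℝ => x i) :=
    ⟨fun _ => 1, fun x => x i, fun _ _ _ => rfl, fun a x y hxy => by simp only [hxy i hi],
      by simp⟩
  have hi : i ∈ P ∪ Q := hcov ▸ Finset.mem_univ i
  exact (Finset.mem_union.1 hi).imp (key P Q) (key Q P)

end SepTerms

theorem saLayer_eq {N H da dx : ℕ} (W : Fin H → HeadWeights da dx) (x : Fin N → Fin dx → ℝ)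
    (i : Fin N) :
    saLayer W x i =
      (∑ h, headOV (W h) * (inputGram Finset.univ x * headKQ (W h))) *ᵥ x i := by
  rw [saLayer, Finset.sum_comm, Matrix.sum_mulVec]
  refine Finset.sum_congr rfl fun h _ => ?_
  rw [inputGram, Finset.sum_mul, Finset.mul_sum, Matrix.sum_mulVec]
  refine Finset.sum_congr rfl fun j _ => ?_
  rw [headOV, headKQ, ← Matrix.mulVec_mulVec, ← Matrix.mulVec_mulVec, ← Matrix.mulVec_mulVec,
    Matrix.vecMulVec_mulVec, ← Matrix.mulVec_mulVec, Matrix.dotProduct_mulVec,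
    Matrix.vecMul_transpose, dotProduct_comm]
  simp only [op_smul_eq_smul, Matrix.mulVec_smul]
  rfl

theorem inputGram_mulVec {N dx : ℕ} (A : Finset (Fin N)) (M : Matrix (Fin dx) (Fin dx) ℝ)
    (x : Fin N → Fin dx → ℝ) :
    inputGram A (fun j => M *ᵥ x j) = M * (inputGram A x * Mᵀ) := by
  simp only [inputGram, Finset.sum_mul, Finset.mul_sum, Matrix.vecMulVec_mul, Matrix.mul_vecMulVec,
    Matrix.vecMul_transpose]

theorem saNetAux_eq {N H da dx : ℕ} (W : ℕ → Fin H → HeadWeights da dx) (l : ℕ)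
    (x : Fin N → Fin dx → ℝ) (i : Fin N) :
    saNetAux W l x i = transfer W l x *ᵥ x i := by
  induction l generalizing i with
  | zero => simp [saNetAux, transfer]
  | succ l ih =>
    rw [saNetAux, saLayer_eq, funext ih, inputGram_mulVec, transfer, Matrix.mulVec_mulVec,
      Finset.sum_mul]
    simp only [Matrix.mul_assoc]

theorem CL_succ (l : ℕ) : CL (l + 1) = 3 * CL l + 1 := by
  have h : 3 ^ l % 2 = 1 := by simp [Nat.pow_mod]
  rw [CL, CL, pow_succ]
  omega

section Transfer

variable {N H da dx : ℕ} {P Q : Finset (Fin N)}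

theorem isSumOf_transfer (hPQ : Disjoint P Q) (hcov : P ∪ Q = Finset.univ)
    (W : ℕ → Fin H → HeadWeights da dx) (l : ℕ) :
    (∀ s ∈ sepTerms dx dx P Q, IsSumOf (sepTerms dx dx P Q) ((H * (da + 1)) ^ CL l)
      (fun x => transfer W l x *ᵥ s x)) ∧
    (∀ s ∈ lowSepTerms dx dx da P Q, IsSumOf (lowSepTerms dx dx da P Q) ((H * (da + 1)) ^ CL l)
      (fun x => (transfer W l x)ᵀ *ᵥ s x)) := by
  induction l with
  | zero =>
    constructor <;> intro s hs <;> simpa [transfer, CL] using IsSumOf.of_mem hs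
  | succ l ih =>
    obtain ⟨ihT, ihTt⟩ := ih
    set R := (H * (da + 1)) ^ CL l with hR
    have hcard : (H * (da + 1)) ^ CL (l + 1) = H * (R * R * (da + 1) * R) := by
      rw [CL_succ, pow_succ, pow_mul', hR]
      ring
    rw [hcard]
    constructor <;> intro s hs
    · have hsum : (fun x => transfer W (l + 1) x *ᵥ s x) = ∑ h, fun x =>
          headOV (W l h) *ᵥ (transfer W l x *ᵥ (inputGram Finset.univ x *ᵥ
            ((transfer W l x)ᵀ *ᵥ (headKQ (W l h) *ᵥ (transfer W l x *ᵥ s x))))) := by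
        funext x
        simp [transfer, Matrix.sum_mulVec, Matrix.mulVec_mulVec]
      rw [hsum]
      refine IsSumOf.sum fun h => ?_
      refine IsSumOf.mulVec_of_mem _ ?_ fun _ => const_mulVec_mem_sepTerms _
      refine IsSumOf.mulVec _ ?_ ihT
      refine IsSumOf.mulVec _ ?_ fun _ => isSumOf_inputGram_mulVec hPQ hcov
      refine IsSumOf.mulVec _ ?_ ihTt
      exact IsSumOf.mulVec_of_mem _ (ihT s hs) fun _ => mul_mulVec_mem_lowSepTerms _ _
    · have hsum : (fun x => (transfer W (l + 1) x)ᵀ *ᵥ s x) = ∑ h, fun x =>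
          (transfer W l x)ᵀ *ᵥ ((headKQ (W l h))ᵀ *ᵥ (transfer W l x *ᵥ (inputGram Finset.univ x *ᵥ
            ((transfer W l x)ᵀ *ᵥ ((headOV (W l h))ᵀ *ᵥ s x))))) := by
        funext x
        have hgram : (inputGram Finset.univ x)ᵀ = inputGram Finset.univ x := by
          simp [inputGram, Matrix.transpose_sum, Matrix.transpose_vecMulVec]
        simp [transfer, Matrix.transpose_sum, Matrix.transpose_mul, Matrix.sum_mulVec,
          Matrix.mulVec_mulVec, hgram, Matrix.mul_assoc]
      rw [hsum]
      refine IsSumOf.sum fun h => ?_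
      rw [show R * R * (da + 1) * R = R * (da + 1) * R * R by ring]
      refine IsSumOf.mulVec _ ?_ ihTt
      have hKQ : (headKQ (W l h))ᵀ = (Matrix.of (W l h).2.1)ᵀ * Matrix.of (W l h).1 := by
        simp [headKQ, Matrix.transpose_mul]
      rw [hKQ]
      refine IsSumOf.mulVec_of_mem _ ?_ fun _ => mul_mulVec_mem_lowSepTerms _ _
      refine IsSumOf.mulVec _ ?_ ihT
      refine IsSumOf.mulVec _ ?_ fun _ => isSumOf_inputGram_mulVec hPQ hcov
      exact ihTt _ (const_mulVec_mem_lowSepTerms _ hs)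

end Transfer

theorem sepRank_le_of_isSumOf {N dx m n : ℕ} {P Q : Finset (Fin N)}
    {f : (Fin N → Fin dx → ℝ) → Fin m → ℝ} (hf : IsSumOf (sepTerms dx m P Q) n f) (p : Fin m) :
    sepRank (fun x => f x p) P Q ≤ (n : ℕ∞) := by
  obtain ⟨F, hF, rfl⟩ := hf
  have key (r : Fin n) : ∃ g g' : (Fin N → Fin dx → ℝ) → ℝ,
      DependsOnlyOn g P ∧ DependsOnlyOn g' Q ∧ ∀ x, F r x p = g x * g' x := by
    obtain ⟨g, v, hg, hv, h⟩ | ⟨g, v, hg, hv, h⟩ := hF r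
    · exact ⟨fun x => v x p, g, hv p, hg, fun x => by simp [h, mul_comm]⟩
    · exact ⟨g, fun x => v x p, hg, hv p, fun x => by simp [h]⟩
  choose g g' hg hg' h using key
  exact sInf_le ⟨n, rfl, g, g', hg, hg', fun x => by simp [Finset.sum_apply, h]⟩

/-- universal upper bound on the separation rank: for any depth `L ≥ 1`,
input size `N > 1`, any partition `[N] = P ⊎ Q` and any output location,
`sep(y_p^{i,L,d_x,H,Θ}; P, Q) ≤ (H·(d_a+1))^{C(L)}`. -/
theorem sepRank_upper_bound_universal
    {L H da dx N : ℕ} (hL : 1 ≤ L) (hN : 1 < N) (hdxda : dx = H * da)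
    (Θ : SAWeights L H da dx)
    (P Q : Finset (Fin N)) (hPQ : Disjoint P Q) (hPQcov : P ∪ Q = Finset.univ)
    (i : Fin N) (p : Fin dx) :
    sepRank (saOutput L N Θ i p) P Q ≤ (((H * (da + 1)) ^ CL L : ℕ) : ℕ∞) := by
  have h := sepRank_le_of_isSumOf
    ((isSumOf_transfer hPQ hPQcov (extendW Θ) L).1 _ (input_mem_sepTerms hPQcov i)) p
  simp only [← saNetAux_eq] at h
  exact h
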